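/- For any hypergraph communication situation (N,v,H), the uniform hyperlink game coincides with the hypergraph-restricted game of the hyperlink agent form: w(S) = v̄^{H̄}(S) for every S⊆N̄, where (N̄,v̄,H̄)=HAF(N,v,H) and N̄=U(H). -/

import Mathlib

open scoped Classical
open Finset

noncomputable section

namespace HGGame

/-! ## Generic hypergraph notions -/

variable {α : Type*}

/-- Two nodes are linked if they lie in a common hyperlink of `E`. -/
def Linked (E : Finset (Finset α)) (a b : α) : Prop :=
  ∃ e ∈ E, a ∈ e ∧ b ∈ e

/-- The component of `i` in the subhypergraph of `(α, E)` induced by the ground set `S`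
(only hyperlinks contained in `S` count). -/
def compOf (E : Finset (Finset α)) (S : Finset α) (i : α) : Finset α :=
  S.filter (fun j => Relation.ReflTransGen (Linked (E.filter (fun e => e ⊆ S))) i j)

/-- The set `S/E` of components of the subhypergraph induced by `S`. -/
def components (E : Finset (Finset α)) (S : Finset α) : Finset (Finset α) :=
  S.image (compOf E S)

/-- The hypergraph-restricted worth `v^E(S) = Σ_{T ∈ S/E} v(T)`. -/
def restrictedWorth (v : Finset α → ℝ) (E : Finset (Finset α)) (S : Finset α) : ℝ :=
  ∑ T ∈ components E S, v T

/-! ## Shapley value -/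

/-- The set `σ^i` of players preceding `i` in the ordering `σ`. -/
def preceding {M : Type*} [Fintype M] (σ : M ≃ Fin (Fintype.card M)) (i : M) : Finset M :=
  Finset.univ.filter (fun j => σ j < σ i)

/-- The marginal contribution `m^σ_i(u) = u(σ^i ∪ {i}) - u(σ^i)`. -/
def marginal {M : Type*} [Fintype M] (u : Finset M → ℝ) (σ : M ≃ Fin (Fintype.card M))
    (i : M) : ℝ :=
  u (insert i (preceding σ i)) - u (preceding σ i)

/-- The Shapley value of the TU-game `(M, u)`. -/
def shapley {M : Type*} [Fintype M] (u : Finset M → ℝ) (i : M) : ℝ :=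
  ((Fintype.card M).factorial : ℝ)⁻¹ * ∑ σ : M ≃ Fin (Fintype.card M), marginal u σ i

/-- The Harsanyi dividend `λ_T(u) = Σ_{∅ ≠ S ⊆ T} (-1)^{|T|-|S|} u(S)`. -/
def dividend {M : Type*} (u : Finset M → ℝ) (T : Finset M) : ℝ :=
  ∑ S ∈ T.powerset.filter (fun S => S ≠ ∅), (-1 : ℝ) ^ (T.card - S.card) * u S

/-! ## Hypergraph communication situations -/

variable {N : Type*} [Fintype N] [DecidableEq N]

/-- The conference game `(H, v^N)`, a TU-game with player set `H`:
`v^N(H') = Σ_{T ∈ N/H'} v(T)`. -/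
def confGame (v : Finset N → ℝ) (H : Finset (Finset N)) (F : Finset {e // e ∈ H}) : ℝ :=
  restrictedWorth v (F.image Subtype.val) Finset.univ

/-- The position value `π_i(N,v,H) = Σ_{e ∈ H_i} (1/|e|) · Sh_e(H, v^N)`. -/
def positionValue (v : Finset N → ℝ) (H : Finset (Finset N)) (i : N) : ℝ :=
  ∑ e ∈ H.attach.filter (fun e => i ∈ e.val),
    ((e.val.card : ℝ))⁻¹ * shapley (confGame v H) e

/-! ## The uniform hyperlink game -/

/-- The type of agents `(i, e, k)` of the uniform hyperlink game. -/
abbrev UElem (N : Type*) := N × Finset N × ℕ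

/-- `η(H)`: the least common multiple of the hyperlink sizes. -/
def eta (H : Finset (Finset N)) : ℕ := H.lcm Finset.card

/-- `U(H)(i,e) = {(i,e,k) : k = 1, …, η(H)/|e|}`. -/
def UHie (H : Finset (Finset N)) (i : N) (e : Finset N) : Finset (UElem N) :=
  (Finset.Icc 1 (eta H / e.card)).image fun k => (i, e, k)

/-- `U(H)(i) = ∪_{e ∈ H_i} U(H)(i,e)`. -/
def UHi (H : Finset (Finset N)) (i : N) : Finset (UElem N) :=
  (H.filter (fun e => i ∈ e)).biUnion fun e => UHie H i e

/-- `U(H)(e) = ∪_{i ∈ e} U(H)(i,e)`. -/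
def UHe (H : Finset (Finset N)) (e : Finset N) : Finset (UElem N) :=
  e.biUnion fun i => UHie H i e

/-- `U(H) = ∪_{i ∈ N} U(H)(i)`. -/
def UH (H : Finset (Finset N)) : Finset (UElem N) :=
  Finset.univ.biUnion fun i : N => UHi H i

/-- `H[S] = {e ∈ H : U(H)(e) ⊆ S}`. -/
def Hof (H : Finset (Finset N)) (S : Finset (UElem N)) : Finset (Finset N) :=
  H.filter fun e => UHe H e ⊆ S

/-- The characteristic function `w(S) = Σ_{R ∈ N/H[S]} v(R)` of the uniform hyperlink game. -/
def uw (v : Finset N → ℝ) (H : Finset (Finset N)) (S : Finset (UElem N)) : ℝ :=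
  restrictedWorth v (Hof H S) Finset.univ

/-- The uniform hyperlink game `(U(H), w)` as a TU-game with player set `U(H)`. -/
def uGame (v : Finset N → ℝ) (H : Finset (Finset N)) (F : Finset {l // l ∈ UH H}) : ℝ :=
  uw v H (F.image Subtype.val)

/-! ## The hyperlink agent form (HAF) -/

variable {N : Type*} [Fintype N] [DecidableEq N]

/-- The hyperlink set `H̄ = {h̄ : h ∈ H} ∪ ∪_{i ∈ N} L^{N̄(i)}` of the hyperlink agent
form, where `h̄ = ∪_{i ∈ h} N̄(i,h) = U(H)(h)` and `L^{N̄(i)}` is the set of all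
2-element subsets of `N̄(i) = U(H)(i)`. -/
def HAFedges (H : Finset (Finset N)) : Finset (Finset (UElem N)) :=
  (H.image fun h => UHe H h) ∪ Finset.univ.biUnion fun i : N => (UHi H i).powersetCard 2

/-- The characteristic function `v̄(K̄) = v(N(K̄))` of the hyperlink agent form, where
`N(K̄) = {i ∈ N : N̄(i) ∩ K̄ ≠ ∅}` and `v̄(∅) = 0`. -/
def barv (v : Finset N → ℝ) (H : Finset (Finset N)) (K : Finset (UElem N)) : ℝ :=
  if K = ∅ then 0 else v (Finset.univ.filter fun i : N => (UHi H i ∩ K).Nonempty)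

/-- Membership in the set of agents of player `i`. -/
theorem mem_UHi {H : Finset (Finset N)} {i : N} {x : UElem N} :
    x ∈ UHi H i ↔ x.1 = i ∧ x.2.1 ∈ H ∧ i ∈ x.2.1 ∧ x.2.2 ∈ Icc 1 (eta H / x.2.1.card) := by
  obtain ⟨j, e, k⟩ := x
  simp only [UHi, UHie, mem_biUnion, mem_filter, mem_image, Prod.mk.injEq]
  constructor
  · rintro ⟨e, ⟨he, hi⟩, k, hk, rfl, rfl, rfl⟩
    exact ⟨rfl, he, hi, hk⟩
  · rintro ⟨rfl, he, hi, hk⟩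
    exact ⟨e, ⟨he, hi⟩, k, hk, rfl, rfl, rfl⟩

theorem mem_UHi_fst {H : Finset (Finset N)} {x : UElem N} (hx : x ∈ UH H) : x ∈ UHi H x.1 := by
  obtain ⟨i, -, hi⟩ := mem_biUnion.1 hx
  obtain rfl := (mem_UHi.1 hi).1
  exact hi

theorem fst_mem_of_mem_UHe {H : Finset (Finset N)} {e : Finset N} {x : UElem N}
    (hx : x ∈ UHe H e) : x.1 ∈ e := by
  simp only [UHe, UHie, mem_biUnion, mem_image] at hx
  obtain ⟨i, hi, k, -, rfl⟩ := hx
  exact hi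

/-- Every player of a hyperlink has at least one agent for it. -/
theorem first_agent_mem_UHe {H : Finset (Finset N)} (hH : ∀ e ∈ H, 1 < e.card)
    {e : Finset N} (he : e ∈ H) {i : N} (hi : i ∈ e) : ((i, e, 1) : UElem N) ∈ UHe H e := by
  have hdvd : e.card ∣ eta H := Finset.dvd_lcm he
  have hne : eta H ≠ 0 := by
    rw [eta, Ne, Finset.lcm_eq_zero_iff]
    rintro ⟨f, hf, h0⟩
    have := hH f hf
    omega
  have hpos : 1 ≤ eta H / e.card :=
    Nat.div_pos (Nat.le_of_dvd (Nat.pos_of_ne_zero hne) hdvd) (by have := hH e he; omega)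
  exact mem_biUnion.2 ⟨i, hi, mem_image.2 ⟨1, mem_Icc.2 ⟨le_rfl, hpos⟩, rfl⟩⟩

/-- Two nodes are connected in the subhypergraph of `(α, E)` induced by `S`. -/
def InducedConnected {α : Type*} (E : Finset (Finset α)) (S : Finset α) : α → α → Prop :=
  Relation.ReflTransGen (Linked (E.filter (fun e => e ⊆ S)))

theorem InducedConnected.symm {α : Type*} {E : Finset (Finset α)} {S : Finset α} {a b : α}
    (h : InducedConnected E S a b) : InducedConnected E S b a := by
  have : Std.Symm (Linked (E.filter (fun e => e ⊆ S))) :=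
    ⟨fun _ _ ⟨e, he, ha, hb⟩ => ⟨e, he, hb, ha⟩⟩
  exact Relation.ReflTransGen.stdSymm.symm _ _ h

theorem mem_compOf {α : Type*} {E : Finset (Finset α)} {S : Finset α} {a b : α} :
    b ∈ compOf E S a ↔ b ∈ S ∧ InducedConnected E S a b :=
  mem_filter

theorem mem_components {α : Type*} {E : Finset (Finset α)} {S T : Finset α} :
    T ∈ components E S ↔ ∃ a ∈ S, compOf E S a = T :=
  mem_image

theorem compOf_congr {α : Type*} {E : Finset (Finset α)} {S : Finset α} {a b : α}
    (h : InducedConnected E S a b) : compOf E S a = compOf E S b :=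
  filter_congr fun _ _ => ⟨h.symm.trans, h.trans⟩

theorem inducedConnected_of_mem {α : Type*} {E : Finset (Finset α)} {S e : Finset α} {a b : α}
    (he : e ∈ E) (heS : e ⊆ S) (ha : a ∈ e) (hb : b ∈ e) : InducedConnected E S a b :=
  .single ⟨e, mem_filter.2 ⟨he, heS⟩, ha, hb⟩

theorem InducedConnected.map {α β : Type*} {E : Finset (Finset α)} {S : Finset α}
    {r : β → β → Prop} (f : α → β)
    (hf : ∀ e ∈ E, e ⊆ S → ∀ a ∈ e, ∀ b ∈ e, Relation.ReflTransGen r (f a) (f b))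
    {a b : α} (h : InducedConnected E S a b) : Relation.ReflTransGen r (f a) (f b) := by
  induction h with
  | refl => exact .refl
  | tail _ hlink ih =>
    obtain ⟨e, he, ha, hb⟩ := hlink
    obtain ⟨he, heS⟩ := mem_filter.1 he
    exact ih.trans (hf e he heS _ ha _ hb)

theorem mem_compOf_univ {E : Finset (Finset N)} {i j : N} :
    j ∈ compOf E univ i ↔ Relation.ReflTransGen (Linked E) i j := by
  simp [compOf]

/-- Two agents in `S` are connected in the hyperlink agent form restricted to `S` exactly when
their players are connected in `H[S]`. -/
theorem agents_connected_iff {H : Finset (Finset N)} (hH : ∀ e ∈ H, 1 < e.card)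
    {S : Finset (UElem N)} (hS : S ⊆ UH H) {x y : UElem N} (hx : x ∈ S) (hy : y ∈ S) :
    InducedConnected (HAFedges H) S x y ↔
      Relation.ReflTransGen (Linked (Hof H S)) x.1 y.1 := by
  constructor
  · intro h
    refine h.map Prod.fst fun e he heS a ha b hb => ?_
    rcases mem_union.1 he with he | he
    · obtain ⟨h, hh, rfl⟩ := mem_image.1 he
      exact .single ⟨h, mem_filter.2 ⟨hh, heS⟩, fst_mem_of_mem_UHe ha, fst_mem_of_mem_UHe hb⟩
    · obtain ⟨i, -, hi⟩ := mem_biUnion.1 he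
      have hsub := (mem_powersetCard.1 hi).1
      rw [(mem_UHi.1 (hsub ha)).1, (mem_UHi.1 (hsub hb)).1]
  · have same_player : ∀ a ∈ S, ∀ b ∈ S, a.1 = b.1 →
        InducedConnected (HAFedges H) S a b := by
      intro a ha b hb hab
      by_cases hne : a = b
      · exact hne ▸ .refl
      · refine inducedConnected_of_mem (e := {a, b}) (mem_union_right _ (mem_biUnion.2
          ⟨a.1, mem_univ _, mem_powersetCard.2 ⟨?_, card_pair hne⟩⟩)) ?_ (by simp) (by simp)
        · have hb' := mem_UHi_fst (hS hb)
          rw [← hab] at hb'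
          simp [insert_subset_iff, mem_UHi_fst (hS ha), hb']
        · simp [insert_subset_iff, ha, hb]
    have reach : ∀ j, Relation.ReflTransGen (Linked (Hof H S)) x.1 j → ∀ z ∈ S, z.1 = j →
        InducedConnected (HAFedges H) S x z := by
      intro j hj
      induction hj with
      | refl => exact fun z hz hzx => same_player x hx z hz hzx.symm
      | tail _ hlink ih =>
        intro z hz hzk
        obtain ⟨e, he, hj, hk⟩ := hlink
        obtain ⟨heH, heS⟩ := mem_filter.1 he
        have hj' := first_agent_mem_UHe hH heH hj
        have hk' := first_agent_mem_UHe hH heH hk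
        refine ((ih _ (heS hj') rfl).trans (inducedConnected_of_mem
          (mem_union_left _ (mem_image_of_mem _ heH)) heS hj' hk')).trans ?_
        exact same_player _ (heS hk') z hz hzk.symm
    exact fun h => reach _ h y hy rfl

/-- A player connected in `H[S]` to a different player has an agent in `S`. -/
theorem exists_agent_of_connected {H : Finset (Finset N)} (hH : ∀ e ∈ H, 1 < e.card)
    {S : Finset (UElem N)} {i j : N} (h : Relation.ReflTransGen (Linked (Hof H S)) i j)
    (hij : i ≠ j) : ∃ y ∈ S, y.1 = j := by
  obtain h | ⟨_, -, e, he, -, hj⟩ := Relation.ReflTransGen.cases_tail h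
  · exact absurd h.symm hij
  · obtain ⟨heH, heS⟩ := mem_filter.1 he
    exact ⟨_, heS (first_agent_mem_UHe hH heH hj), rfl⟩

/-- The players represented in the component of the agent `x` form the component of its player
in `H[S]`. -/
theorem players_compOf {H : Finset (Finset N)} (hH : ∀ e ∈ H, 1 < e.card)
    {S : Finset (UElem N)} (hS : S ⊆ UH H) {x : UElem N} (hx : x ∈ S) :
    (univ.filter fun i : N => (UHi H i ∩ compOf (HAFedges H) S x).Nonempty) =
      compOf (Hof H S) univ x.1 := by
  ext j
  simp only [mem_filter, mem_univ, true_and, mem_compOf_univ]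
  constructor
  · rintro ⟨y, hy⟩
    obtain ⟨hyj, hyc⟩ := mem_inter.1 hy
    obtain ⟨hyS, hxy⟩ := mem_compOf.1 hyc
    rw [← (mem_UHi.1 hyj).1]
    exact (agents_connected_iff hH hS hx hyS).1 hxy
  · intro h
    have hex : ∃ y ∈ S, y.1 = j := by
      by_cases hxj : x.1 = j
      · exact ⟨x, hx, hxj⟩
      · exact exists_agent_of_connected hH h hxj
    obtain ⟨y, hy, rfl⟩ := hex
    exact ⟨y, mem_inter.2 ⟨mem_UHi_fst (hS hy),
      mem_compOf.2 ⟨hy, (agents_connected_iff hH hS hx hy).2 h⟩⟩⟩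

theorem barv_compOf (v : Finset N → ℝ) {H : Finset (Finset N)} (hH : ∀ e ∈ H, 1 < e.card)
    {S : Finset (UElem N)} (hS : S ⊆ UH H) {x : UElem N} (hx : x ∈ S) :
    barv v H (compOf (HAFedges H) S x) = v (compOf (Hof H S) univ x.1) := by
  have hne : compOf (HAFedges H) S x ≠ ∅ :=
    ne_empty_of_mem (mem_compOf.2 ⟨hx, .refl⟩ : x ∈ compOf (HAFedges H) S x)
  rw [barv, if_neg hne, players_compOf hH hS hx]

/-- The characteristic function of the uniform hyperlink game coincides with the
hypergraph-restricted game of the hyperlink agent form: `w(S) = v̄^{H̄}(S)` for all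
`S ⊆ N̄ = U(H)`. -/
theorem uniform_hyperlink_game_eq_HAF_restricted_game
    (v : Finset N → ℝ) (H : Finset (Finset N))
    (hN : 2 ≤ Fintype.card N)
    (hv0 : v ∅ = 0) (hzn : ∀ i : N, v {i} = 0)
    (hH : ∀ e ∈ H, 1 < e.card) :
    ∀ S ⊆ UH H, uw v H S = restrictedWorth (barv v H) (HAFedges H) S := by
  intro S hS
  have hsub : S.image (fun x => compOf (Hof H S) univ x.1) ⊆ components (Hof H S) univ := by
    intro T hT
    obtain ⟨x, -, rfl⟩ := mem_image.1 hT
    exact mem_components.2 ⟨_, mem_univ _, rfl⟩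
  have hzero : ∀ T ∈ components (Hof H S) univ,
      T ∉ S.image (fun x => compOf (Hof H S) univ x.1) → v T = 0 := by
    intro T hT hTS
    obtain ⟨i, -, rfl⟩ := mem_components.1 hT
    have hi : compOf (Hof H S) univ i = {i} := by
      ext j
      rw [mem_compOf_univ, mem_singleton]
      refine ⟨fun h => ?_, fun h => h ▸ .refl⟩
      by_contra hji
      obtain ⟨y, hy, rfl⟩ := exists_agent_of_connected hH h (Ne.symm hji)
      refine hTS (mem_image.2 ⟨y, hy, (compOf_congr ?_).symm⟩)
      simpa [InducedConnected] using h
    rw [hi, hzn]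
  rw [uw, restrictedWorth, ← sum_subset hsub hzero, restrictedWorth]
  symm
  refine sum_bij (fun K _ => univ.filter fun i : N => (UHi H i ∩ K).Nonempty) ?_ ?_ ?_ ?_
  · intro K hK
    obtain ⟨x, hx, rfl⟩ := mem_components.1 hK
    rw [players_compOf hH hS hx]
    exact mem_image.2 ⟨x, hx, rfl⟩
  · intro K hK L hL hKL
    obtain ⟨x, hx, rfl⟩ := mem_components.1 hK
    obtain ⟨y, hy, rfl⟩ := mem_components.1 hL
    rw [players_compOf hH hS hx, players_compOf hH hS hy] at hKL
    refine compOf_congr ((agents_connected_iff hH hS hx hy).2 ?_)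
    rw [← mem_compOf_univ, hKL, mem_compOf_univ]
  · intro T hT
    obtain ⟨x, hx, rfl⟩ := mem_image.1 hT
    exact ⟨_, mem_components.2 ⟨x, hx, rfl⟩, players_compOf hH hS hx⟩
  · intro K hK
    obtain ⟨x, hx, rfl⟩ := mem_components.1 hK
    rw [barv_compOf v hH hS hx, players_compOf hH hS hx]

end HGGame
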